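/- In a weakly sequentially complete Banach space, every weakly unconditionally convergent series is unconditionally convergent. -/

import Mathlib

/-- A Banach space is weakly sequentially complete if every weakly Cauchy sequence
converges weakly. -/
def WeaklySequentiallyComplete (X : Type*) [NormedAddCommGroup X] [NormedSpace ℝ X] : Prop :=
  ∀ u : ℕ → X, (∀ φ : X →L[ℝ] ℝ, CauchySeq fun n => φ (u n)) →
    ∃ y : X, ∀ φ : X →L[ℝ] ℝ,
      Filter.Tendsto (fun n => φ (u n)) Filter.atTop (nhds (φ y))

theorem op_summable {X : Type*} [NormedAddCommGroup X] [NormedSpace ℝ X] [CompleteSpace X]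
    (hX : WeaklySequentiallyComplete X) (x : ℕ → X)
    (hwuc : ∀ φ : X →L[ℝ] ℝ, Summable fun n => |φ (x n)|) : Summable x := by
  classical
  -- weak sums of all subseries
  have hsum : ∀ (a : ℕ → Bool) (φ : X →L[ℝ] ℝ),
      Summable fun n => if a n then φ (x n) else 0 := by
    intro a φ
    refine Summable.of_norm_bounded (hwuc φ) fun n => ?_
    split_ifs <;> simp
  have hex : ∀ a : ℕ → Bool, ∃ y : X, ∀ φ : X →L[ℝ] ℝ,
      φ y = ∑' n, if a n then φ (x n) else 0 := by
    intro a
    have key : ∀ φ : X →L[ℝ] ℝ, Filter.Tendsto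
        (fun N => φ (∑ n ∈ Finset.range N, if a n then x n else 0)) Filter.atTop
        (nhds (∑' n, if a n then φ (x n) else 0)) := by
      intro φ
      have h := (hsum a φ).hasSum.tendsto_sum_nat
      refine h.congr fun N => ?_
      rw [map_sum]
      refine Finset.sum_congr rfl fun n _ => ?_
      split_ifs <;> simp
    obtain ⟨y, hy⟩ := hX (fun N => ∑ n ∈ Finset.range N, if a n then x n else 0)
      (fun φ => (key φ).cauchySeq)
    exact ⟨y, fun φ => tendsto_nhds_unique (hy φ) (key φ)⟩
  choose f hf using hex
  have hcont : ∀ φ : X →L[ℝ] ℝ, Continuous fun a => φ (f a) := by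
    intro φ
    simp_rw [hf]
    refine continuous_tsum (fun n => ?_) (hwuc φ) fun n a => ?_
    · exact (continuous_of_discreteTopology
        (f := fun b : Bool => if b then φ (x n) else 0)).comp (continuous_apply n)
    · split_ifs <;> simp
  -- separable closed span
  let Y : Submodule ℝ X := (Submodule.span ℝ (Set.range x)).topologicalClosure
  have hYc : IsClosed (Y : Set X) := Submodule.isClosed_topologicalClosure _
  have hxY : ∀ n, x n ∈ Y := fun n =>
    Submodule.le_topologicalClosure _ (Submodule.subset_span ⟨n, rfl⟩)
  have hYsep : TopologicalSpace.IsSeparable (Y : Set X) := by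
    have h : TopologicalSpace.IsSeparable (Set.range x) :=
      (Set.countable_range x).isSeparable
    have := (h.span (R := ℝ)).closure
    simpa [Y, Submodule.topologicalClosure_coe] using this
  have hfY : ∀ a, f a ∈ Y := by
    intro a
    by_contra hna
    obtain ⟨φ, u, h1, h2⟩ := geometric_hahn_banach_closed_point Y.convex hYc hna
    have hz : ∀ y ∈ Y, φ y = 0 := by
      intro y hy
      by_contra hne
      have := h1 ((u / φ y) • y) (Y.smul_mem _ hy)
      rw [map_smul, smul_eq_mul, div_mul_cancel₀ _ hne] at this
      exact lt_irrefl _ this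
    have h0 : 0 < u := by simpa using h1 0 Y.zero_mem
    have : φ (f a) = 0 := by
      rw [hf]
      simp [hz _ (hxY _)]
    linarith
  obtain ⟨D, hDc, hD⟩ := hYsep
  rw [summable_iff_vanishing_norm]
  intro ε hε
  have hDc' : Countable D := hDc
  obtain ⟨d, a, ha⟩ := nonempty_interior_of_iUnion_of_closed
    (f := fun d : D => {a : ℕ → Bool | ‖f a - d‖ ≤ ε / 3}) (by
      intro d
      have : {a : ℕ → Bool | ‖f a - d‖ ≤ ε / 3} =
          ⋂ φ : X →L[ℝ] ℝ, {a | ‖φ (f a) - φ d‖ ≤ ε / 3 * ‖φ‖} := by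
        ext a
        simp only [Set.mem_ofPred_eq, Set.mem_iInter]
        constructor
        · intro h φ
          rw [← map_sub]
          exact (φ.le_opNorm _).trans (by
            rw [mul_comm]; exact mul_le_mul_of_nonneg_right h (norm_nonneg _))
        · intro h
          refine NormedSpace.norm_le_dual_bound ℝ _ (by positivity) fun φ => ?_
          have := h φ
          rwa [← map_sub] at this
      rw [this]
      exact isClosed_iInter fun φ =>
        isClosed_le ((hcont φ).sub continuous_const).norm continuous_const) (by
      rw [Set.eq_univ_iff_forall]
      intro a
      obtain ⟨d, hd, hda⟩ := Metric.mem_closure_iff.1 (hD (hfY a)) (ε / 3) (by positivity)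
      rw [Set.mem_iUnion]
      refine ⟨⟨d, hd⟩, ?_⟩
      rw [dist_eq_norm] at hda
      exact hda.le)
  obtain ⟨I, u, hu, hsub⟩ := isOpen_pi_iff.1 isOpen_interior a ha
  refine ⟨I, fun t ht => ?_⟩
  have hmem : ∀ v : Bool, ‖f (fun n => if n ∈ t then v else a n) - d‖ ≤ ε / 3 := by
    intro v
    suffices hs : (fun n => if n ∈ t then v else a n) ∈ (I : Set ℕ).pi u by
      have h3 := interior_subset (hsub hs)
      exact h3
    intro n hn
    have : n ∉ t := fun h => Finset.disjoint_left.1 ht h hn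
    simp only [this, if_false]
    exact (hu n hn).2
  have hdiff : ∑ n ∈ t, x n =
      f (fun n => if n ∈ t then true else a n) - f (fun n => if n ∈ t then false else a n) := by
    rw [SeparatingDual.eq_iff_forall_dual_eq (R := ℝ)]
    intro φ
    rw [map_sub, hf, hf, ← (hsum _ φ).tsum_sub (hsum _ φ), map_sum]
    rw [tsum_eq_sum (s := t)]
    · refine Finset.sum_congr rfl fun n hn => ?_
      simp [hn]
    · intro n hn
      simp [hn]
  rw [hdiff, ← sub_sub_sub_cancel_right _ _ (d : X)]
  have := norm_sub_le (f (fun n => if n ∈ t then true else a n) - (d : X))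
    (f (fun n => if n ∈ t then false else a n) - d)
  have h1 := hmem true
  have h2 := hmem false
  linarith

theorem stmt_10 {X : Type*} [NormedAddCommGroup X] [NormedSpace ℝ X] [CompleteSpace X]
    (hX : WeaklySequentiallyComplete X) (x : ℕ → X)
    (hwuc : ∀ φ : X →L[ℝ] ℝ, Summable fun n => |φ (x n)|) :
    ∀ ε : ℕ → ℝ, (∀ n, ε n = 1 ∨ ε n = -1) →
      ∃ y : X, Filter.Tendsto (fun N => ∑ n ∈ Finset.range N, ε n • x n)
        Filter.atTop (nhds y) := by
  intro ε hε
  have h : Summable fun n => ε n • x n := by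
    refine op_summable hX _ fun φ => (hwuc φ).congr fun n => ?_
    rcases hε n with h | h <;> simp [h]
  exact ⟨_, h.hasSum.tendsto_sum_nat⟩
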